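/- arXiv:1911.10871 — 6 statements merged into one kernel-verified Lean document; each statement's English description precedes it below -/
import Mathlib

section
/- Let ε ∈ (0,1] with 1/ε ∈ ℕ. Then there exist pairs of positive reals (μ_1,δ_1),…,(μ_{1/ε},δ_{1/ε}) (explicitly, one may take δ_k = ε^{10k/ε^k} and μ_k = ε^{10(k+1)/ε^{k+1}}) such that: (i) for every k ∈ {1,…,1/ε} one has ε^{10(1/ε+1)/ε^{(1/ε)+1}} ≤ μ_k ≤ ε^{10}·δ_k^{1/ε} and δ_k ≤ ε; and (ii) for every finite set T of tasks with nonnegative weights w_i, positive demands d_i and positive bottleneck values b_i, there is an index k* ∈ {1,…,1/ε} with ∑_{i ∈ T : μ_{k*}·b_i < d_i ≤ δ_{k*}·b_i} w_i ≤ ε · ∑_{i∈T} w_i. -/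
open Classical in
/-- Gap lemma: there are pairs `(μ_k, δ_k)` for `k = 1, …, 1/ε` with
`ε^{10(1/ε+1)/ε^{(1/ε)+1}} ≤ μ_k ≤ ε^{10}·δ_k^{1/ε}`, `δ_k ≤ ε`, such that for every
finite weighted set of tasks some range `(μ_{k*}·b_i, δ_{k*}·b_i]` carries weight at most
`ε` times the total weight. -/
theorem gap_lemma (ε : ℝ) (hε0 : 0 < ε) (hε1 : ε ≤ 1) (N : ℕ) (hN : ε = 1 / (N : ℝ)) :
    ∃ μ δ : ℕ → ℝ,
      (∀ k ∈ Finset.Icc 1 N, 0 < μ k ∧ 0 < δ k) ∧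
      (∀ k ∈ Finset.Icc 1 N,
        ε ^ ((10 * (1 / ε + 1)) / ε ^ (1 / ε + 1)) ≤ μ k ∧
        μ k ≤ ε ^ (10 : ℝ) * δ k ^ (1 / ε) ∧
        δ k ≤ ε) ∧
      (∀ (ι : Type) (T : Finset ι) (w d b : ι → ℝ),
        (∀ i ∈ T, 0 ≤ w i) → (∀ i ∈ T, 0 < d i) → (∀ i ∈ T, 0 < b i) →
        ∃ k ∈ Finset.Icc 1 N,
          ∑ i ∈ T.filter (fun i => μ k * b i < d i ∧ d i ≤ δ k * b i), w i
            ≤ ε * ∑ i ∈ T, w i) := by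
  have hNpos : 1 ≤ N := by
    rcases Nat.eq_zero_or_pos N with h | h
    · subst h; simp at hN; linarith
    · exact h
  have hNr : (0 : ℝ) < N := by exact_mod_cast hNpos
  have hinv : 1 / ε = (N : ℝ) := by rw [hN]; field_simp
  have hpow : ∀ k : ℕ, 1 ≤ N ^ k := fun k => Nat.one_le_pow _ _ hNpos
  have hmono : ∀ k l : ℕ, k ≤ l →
      ε ^ (10 * l * N ^ l) ≤ ε ^ (10 * k * N ^ k) := by
    intro k l hkl
    apply pow_le_pow_of_le_one hε0.le hε1
    exact Nat.mul_le_mul (Nat.mul_le_mul le_rfl hkl) (Nat.pow_le_pow_right hNpos hkl)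
  refine ⟨fun k => ε ^ (10 * (k + 1) * N ^ (k + 1)), fun k => ε ^ (10 * k * N ^ k),
    fun k _ => ⟨by positivity, by positivity⟩, ?_, ?_⟩
  · intro k hk
    obtain ⟨hk1, hkN⟩ := Finset.mem_Icc.mp hk
    refine ⟨?_, ?_, ?_⟩
    · have e : (10 * (1 / ε + 1)) / ε ^ (1 / ε + 1)
          = ((10 * (N + 1) * N ^ (N + 1) : ℕ) : ℝ) := by
        rw [hinv]
        have h1 : ((N : ℝ) + 1) = ((N + 1 : ℕ) : ℝ) := by push_cast; rfl
        rw [h1, Real.rpow_natCast, hN]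
        push_cast
        rw [one_div, inv_pow, div_inv_eq_mul]
      rw [e, Real.rpow_natCast]
      exact hmono (k + 1) (N + 1) (by omega)
    · rw [hinv, Real.rpow_natCast]
      have h10 : ε ^ (10 : ℝ) = ε ^ (10 : ℕ) := by
        rw [← Real.rpow_natCast]; norm_num
      rw [h10]
      show ε ^ (10 * (k + 1) * N ^ (k + 1)) ≤ ε ^ 10 * (ε ^ (10 * k * N ^ k)) ^ N
      rw [← pow_mul, ← pow_add]
      apply pow_le_pow_of_le_one hε0.le hε1
      have := hpow (k + 1)
      have e : 10 * k * N ^ k * N = 10 * k * N ^ (k + 1) := by ring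
      rw [e]
      nlinarith
    · show ε ^ (10 * k * N ^ k) ≤ ε
      apply pow_le_of_le_one hε0.le hε1
      have := hpow k
      have : 0 < 10 * k * N ^ k := by positivity
      omega
  · intro ι T w d b hw hd hb
    by_contra! hcon
    have hlt := Finset.sum_lt_sum_of_nonempty (Finset.nonempty_Icc.mpr hNpos) hcon
    rw [← Finset.sum_biUnion] at hlt
    · have hle := Finset.sum_le_sum_of_subset_of_nonneg (f := w)
        (s := (Finset.Icc 1 N).biUnion (fun k => T.filter (fun i =>
          ε ^ (10 * (k + 1) * N ^ (k + 1)) * b i < d i ∧ d i ≤ ε ^ (10 * k * N ^ k) * b i)))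
        (t := T) (by
          intro i hi
          obtain ⟨k, _, hk⟩ := Finset.mem_biUnion.mp hi
          exact (Finset.mem_filter.mp hk).1) (fun i hi _ => hw i hi)
      have e : ∑ _k ∈ Finset.Icc 1 N, ε * ∑ i ∈ T, w i = ∑ i ∈ T, w i := by
        rw [Finset.sum_const, Nat.card_Icc, nsmul_eq_mul, hN]
        simp only [Nat.add_sub_cancel]
        field_simp
      rw [e] at hlt
      exact absurd hle (not_le.mpr hlt)
    · have key : ∀ k l : ℕ, k < l → ∀ i ∈ T,
          ε ^ (10 * (k + 1) * N ^ (k + 1)) * b i < d i →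
          d i ≤ ε ^ (10 * l * N ^ l) * b i → False := by
        intro k l hkl i hi h1 h2
        have := mul_le_mul_of_nonneg_right (hmono (k + 1) l hkl) (hb i hi).le
        linarith
      intro k _ l _ hkl
      refine Finset.disjoint_left.mpr ?_
      intro i hi hj
      obtain ⟨hT, h1, h2⟩ := Finset.mem_filter.mp hi
      obtain ⟨_, h3, h4⟩ := Finset.mem_filter.mp hj
      rcases lt_or_gt_of_ne hkl with h | h
      · exact key k l h i hT h1 h4
      · exact key l k h i hT h3 h2
end

section
/- Let ε ∈ (0,1/2] with 1/ε ∈ ℕ and let η ∈ (0,1). Then there exist pairs of positive reals (μ_1,δ_1),…,(μ_{1/ε},δ_{1/ε}) (explicitly, one may take δ_k = ε^{10k/ε^k}·η^{k·(1/ε)^k} and μ_k = δ_{k+1}) such that: (i) for every k ∈ {1,…,1/ε} one has (ε·η)^{10(1/ε+1)/ε^{(1/ε)+1}} ≤ μ_k ≤ ε^{10}·δ_k^{1/ε}·η^{2/ε} and δ_k ≤ ε; and (ii) for every finite set T of tasks with nonnegative weights w_i, positive demands d_i and positive bottleneck values b_i, there is an index k* ∈ {1,…,1/ε} with ∑_{i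 ∈ T : μ_{k*}·b_i < d_i ≤ δ_{k*}·b_i} w_i ≤ ε · ∑_{i∈T} w_i. -/
open Classical in
/-- Strengthened gap lemma (resource augmentation with parameter `η`): there are pairs
`(μ_k, δ_k)` for `k = 1, …, 1/ε` with
`(εη)^{10(1/ε+1)/ε^{(1/ε)+1}} ≤ μ_k ≤ ε^{10}·δ_k^{1/ε}·η^{2/ε}`, `δ_k ≤ ε`, such that for
every finite weighted set of tasks some range `(μ_{k*}·b_i, δ_{k*}·b_i]` carries weight at
most `ε` times the total weight. -/
theorem mu_gap_lemma (ε η : ℝ) (hε0 : 0 < ε) (hε1 : ε ≤ 1 / 2) (N : ℕ)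
    (hN : ε = 1 / (N : ℝ)) (hη0 : 0 < η) (hη1 : η < 1) :
    ∃ μ δ : ℕ → ℝ,
      (∀ k ∈ Finset.Icc 1 N, 0 < μ k ∧ 0 < δ k) ∧
      (∀ k ∈ Finset.Icc 1 N,
        (ε * η) ^ ((10 * (1 / ε + 1)) / ε ^ (1 / ε + 1)) ≤ μ k ∧
        μ k ≤ ε ^ (10 : ℝ) * δ k ^ (1 / ε) * η ^ (2 / ε) ∧
        δ k ≤ ε) ∧
      (∀ (ι : Type) (T : Finset ι) (w d b : ι → ℝ),
        (∀ i ∈ T, 0 ≤ w i) → (∀ i ∈ T, 0 < d i) → (∀ i ∈ T, 0 < b i) →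
        ∃ k ∈ Finset.Icc 1 N,
          ∑ i ∈ T.filter (fun i => μ k * b i < d i ∧ d i ≤ δ k * b i), w i
            ≤ ε * ∑ i ∈ T, w i) := by
  have hNpos : 0 < (N : ℝ) := by
    rcases Nat.eq_zero_or_pos N with h | h
    · subst h; simp at hN; linarith
    · exact_mod_cast h
  have hinv : 1 / ε = (N : ℝ) := by rw [hN]; simp
  have hN2 : 2 ≤ N := by
    have : (2 : ℝ) ≤ N := by
      rw [← hinv, le_div_iff₀ hε0]; linarith
    exact_mod_cast this
  have hεl : ε ≤ 1 := by linarith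
  have hηl : η ≤ 1 := hη1.le
  set D : ℕ → ℝ := fun k => ε ^ (10 * (k * N ^ k)) * η ^ (k * N ^ k) with hD
  have hDpos : ∀ k, 0 < D k := fun k => by simp only [hD]; positivity
  have hmono : Monotone (fun k : ℕ => k * N ^ k) := by
    intro a b hab
    exact Nat.mul_le_mul hab (Nat.pow_le_pow_right (by omega) hab)
  have hanti : Antitone D := by
    intro a b hab
    have h := hmono hab
    simp only at h
    simp only [hD]
    exact mul_le_mul (pow_le_pow_of_le_one hε0.le hεl (by omega))
      (pow_le_pow_of_le_one hη0.le hηl h) (by positivity) (by positivity)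
  refine ⟨fun k => D (k + 1), D, fun k _ => ⟨hDpos _, hDpos _⟩, ?_, ?_⟩
  · intro k hk
    rw [Finset.mem_Icc] at hk
    refine ⟨?_, ?_, ?_⟩
    · have hexp : (10 * (1 / ε + 1)) / ε ^ (1 / ε + 1)
          = ((10 * ((N + 1) * N ^ (N + 1)) : ℕ) : ℝ) := by
        rw [hinv]
        have : ε ^ ((N : ℝ) + 1) = ε ^ (N + 1) := by
          rw [← Real.rpow_natCast]; push_cast; rfl
        rw [this, hN, one_div, inv_pow, div_inv_eq_mul]
        push_cast
        ring
      rw [hexp, Real.rpow_natCast, mul_pow]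
      refine le_trans ?_ (hanti (show k + 1 ≤ N + 1 by omega))
      simp only [hD]
      exact mul_le_mul_of_nonneg_left
        (pow_le_pow_of_le_one hη0.le hηl (by omega)) (by positivity)
    · have h2 : 2 / ε = ((2 * N : ℕ) : ℝ) := by
        push_cast; rw [← hinv]; ring
      have h10 : (10 : ℝ) = ((10 : ℕ) : ℝ) := by norm_num
      have e10 : ε ^ (10 : ℝ) = ε ^ (10 : ℕ) := by
        rw [h10, Real.rpow_natCast]
      rw [e10, h2, hinv, Real.rpow_natCast, Real.rpow_natCast]
      simp only [hD]
      have hp : 2 ≤ N ^ k := le_trans hN2 (Nat.le_self_pow (by omega) N)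
      have hp2 : 2 * N ≤ N ^ k * N := Nat.mul_le_mul_right _ hp
      have hE : (k + 1) * N ^ (k + 1) = k * N ^ k * N + N ^ k * N := by ring
      have : ε ^ 10 * (ε ^ (10 * (k * N ^ k)) * η ^ (k * N ^ k)) ^ N * η ^ (2 * N)
          = ε ^ (10 + 10 * (k * N ^ k * N)) * η ^ (k * N ^ k * N + 2 * N) := by
        rw [mul_pow, ← pow_mul, ← pow_mul, pow_add, pow_add,
          show 10 * (k * N ^ k) * N = 10 * (k * N ^ k * N) by ring]
        ring
      rw [this, hE]
      exact mul_le_mul (pow_le_pow_of_le_one hε0.le hεl (by omega))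
        (pow_le_pow_of_le_one hη0.le hηl (by omega)) (by positivity) (by positivity)
    · have hp : 0 < k * N ^ k := Nat.mul_pos (by omega) (Nat.pow_pos (by omega))
      calc D k ≤ ε ^ 1 * 1 := mul_le_mul (pow_le_pow_of_le_one hε0.le hεl (by omega))
            (pow_le_one₀ hη0.le hηl) (by positivity) (by positivity)
        _ = ε := by ring
  · intro ι T w d b hw hd hb
    by_contra! hcon
    have hne : (Finset.Icc 1 N).Nonempty := ⟨1, by simp; omega⟩
    have h1 := Finset.sum_lt_sum_of_nonempty hne hcon
    have hdis : ((Finset.Icc 1 N : Finset ℕ) : Set ℕ).PairwiseDisjoint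
        (fun k => T.filter (fun i => D (k + 1) * b i < d i ∧ d i ≤ D k * b i)) := by
      have key : ∀ k l : ℕ, k < l → ∀ i ∈ T, D (k + 1) * b i < d i → d i ≤ D l * b i → False := by
        intro k l hkl i hi h1 h2
        have := mul_le_mul_of_nonneg_right (hanti (show k + 1 ≤ l from hkl)) (hb i hi).le
        linarith
      intro k _ l _ hkl
      simp only [Function.onFun]
      rw [Finset.disjoint_left]
      intro i hi hj
      rw [Finset.mem_filter] at hi hj
      rcases lt_or_gt_of_ne hkl with h | h
      · exact key k l h i hi.1 hi.2.1 hj.2.2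
      · exact key l k h i hi.1 hj.2.1 hi.2.2
    rw [← Finset.sum_biUnion hdis, Finset.sum_const, Nat.card_Icc, nsmul_eq_mul,
      Nat.add_sub_cancel, ← mul_assoc, ← hinv, one_div_mul_cancel hε0.ne', one_mul] at h1
    refine absurd h1 (not_lt.mpr ?_)
    refine Finset.sum_le_sum_of_subset_of_nonneg ?_ (fun i hi _ => hw i hi)
    intro i hi
    rw [Finset.mem_biUnion] at hi
    obtain ⟨k, _, hk⟩ := hi
    exact (Finset.mem_filter.mp hk).1
end

section
/- Fix δ ∈ (0,1) with 1/δ² ∈ ℕ. Let (T', h) be a feasible SAP solution and let e be an edge with u_e ≥ 1. Then the number of δ-large tasks i ∈ T' with e ∈ P(i) is at most (1/δ²)·(log u_e / log(1/δ) + 1). -/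
/-- A task in the Storage Allocation Problem: a nonempty interval of edges `Icc s t`,
an integer demand `d ≥ 1` and a nonnegative weight `w`. -/
structure SAPTask where
  s : ℕ
  t : ℕ
  hst : s ≤ t
  d : ℕ
  hd : 1 ≤ d
  w : ℝ
  hw : 0 ≤ w

/-- The path of a task: the interval of edges between its start and end vertex. -/
def SAPTask.P (i : SAPTask) : Finset ℕ := Finset.Icc i.s i.t

/-- The bottleneck capacity of a task: the minimum capacity along its path. -/
def SAPTask.b (u : ℕ → ℕ) (i : SAPTask) : ℕ :=
  i.P.inf' (Finset.nonempty_Icc.mpr i.hst) u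

/-- Feasibility of a SAP solution `(T', h)`: every task fits under the capacity of each
edge of its path, and tasks whose paths share an edge occupy disjoint height intervals. -/
def SAPFeasible (u : ℕ → ℕ) (T' : Finset SAPTask) (h : SAPTask → ℕ) : Prop :=
  (∀ i ∈ T', ∀ e ∈ i.P, h i + i.d ≤ u e) ∧
  (∀ i ∈ T', ∀ i' ∈ T', i ≠ i' → (i.P ∩ i'.P).Nonempty →
    (h i + i.d ≤ h i' ∨ h i' + i'.d ≤ h i))

theorem aux_growth (δ : ℝ) (h : SAPTask → ℕ) (n : ℕ) :
    ∀ (S : Finset SAPTask) (U : ℝ), S.card = n + 1 →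
      (∀ i ∈ S, ((h i : ℝ) + i.d) ≤ U) →
      (∀ i ∈ S, δ * ((h i : ℝ) + i.d) ≤ i.d) →
      (∀ i ∈ S, ∀ j ∈ S, i ≠ j → (h i + i.d ≤ h j ∨ h j + j.d ≤ h i)) →
      Real.exp (δ * n) ≤ U := by
  classical
  induction n with
  | zero =>
    intro S U hc hU _ _
    obtain ⟨i, hi⟩ := Finset.card_pos.mp (by omega : 0 < S.card)
    have h1 := hU i hi
    have h2 : (1 : ℝ) ≤ i.d := by exact_mod_cast i.hd
    have h3 : (0 : ℝ) ≤ h i := Nat.cast_nonneg _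
    simp
    linarith
  | succ n ih =>
    intro S U hc hU hL hD
    obtain ⟨i, hi, hmax⟩ := Finset.exists_max_image S h
      (Finset.card_pos.mp (by omega : 0 < S.card))
    have key := ih (S.erase i) (h i) (by rw [Finset.card_erase_of_mem hi]; omega)
      (by
        intro j hj
        have hjS := Finset.mem_of_mem_erase hj
        have hne := Finset.ne_of_mem_erase hj
        have h1 := hmax j hjS
        have h2 := i.hd
        rcases hD j hjS i hi hne with h3 | h3
        · exact_mod_cast h3
        · omega)
      (fun j hj => hL j (Finset.mem_of_mem_erase hj))
      (fun j hj k hk => hD j (Finset.mem_of_mem_erase hj) k (Finset.mem_of_mem_erase hk))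
    have h1 := hL i hi
    have h2 := hU i hi
    have h3 : 1 - δ ≤ Real.exp (-δ) := Real.one_sub_le_exp_neg δ
    have h4 : (0 : ℝ) ≤ (h i : ℝ) + i.d := by positivity
    have h5 : Real.exp (δ * n) ≤ Real.exp (-δ) * U :=
      calc Real.exp (δ * n) ≤ h i := key
        _ ≤ (1 - δ) * ((h i : ℝ) + i.d) := by linarith
        _ ≤ Real.exp (-δ) * ((h i : ℝ) + i.d) := mul_le_mul_of_nonneg_right h3 h4
        _ ≤ Real.exp (-δ) * U := mul_le_mul_of_nonneg_left h2 (Real.exp_pos _).le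
    calc Real.exp (δ * (n + 1 : ℕ)) = Real.exp δ * Real.exp (δ * n) := by
          rw [← Real.exp_add]; congr 1; push_cast; ring
      _ ≤ Real.exp δ * (Real.exp (-δ) * U) := mul_le_mul_of_nonneg_left h5 (Real.exp_pos _).le
      _ = U := by rw [← mul_assoc, ← Real.exp_add]; simp

open Classical in
/-- In any feasible SAP solution, each edge `e` with `u_e ≥ 1` is used by at most
`(1/δ²)·(log u_e / log(1/δ) + 1)` many `δ`-large tasks. -/
theorem few_large_tasks (δ : ℝ) (hδ0 : 0 < δ) (hδ1 : δ < 1) (m : ℕ)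
    (hm : (m : ℝ) = 1 / δ ^ 2) (u : ℕ → ℕ) (T' : Finset SAPTask) (h : SAPTask → ℕ)
    (hfeas : SAPFeasible u T' h) (e : ℕ) (hue : 1 ≤ u e) :
    ((T'.filter (fun i => e ∈ i.P ∧ δ * (SAPTask.b u i : ℝ) < (i.d : ℝ))).card : ℝ)
      ≤ (1 / δ ^ 2) * (Real.log (u e) / Real.log (1 / δ) + 1) := by
  obtain ⟨hcap, hdis⟩ := hfeas
  set S := T'.filter (fun i => e ∈ i.P ∧ δ * (SAPTask.b u i : ℝ) < (i.d : ℝ)) with hS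
  have hu1 : (1 : ℝ) ≤ u e := by exact_mod_cast hue
  have hlogu : 0 ≤ Real.log (u e) := Real.log_nonneg hu1
  have hinv : 1 < 1 / δ := by rw [lt_div_iff₀ hδ0]; linarith
  have hlogd : 0 < Real.log (1 / δ) := Real.log_pos hinv
  have hlogd2 : Real.log (1 / δ) ≤ 1 / δ := by
    have := Real.log_le_sub_one_of_pos (by linarith : 0 < 1 / δ)
    linarith
  have hsq : 1 / δ ^ 2 = (1 / δ) * (1 / δ) := by field_simp
  have hq : 0 ≤ Real.log (u e) / Real.log (1 / δ) := by positivity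
  rcases Nat.eq_zero_or_pos S.card with h0 | hpos
  · rw [h0]
    push_cast
    positivity
  obtain ⟨n, hn⟩ : ∃ n, S.card = n + 1 := ⟨S.card - 1, by omega⟩
  have hmem : ∀ i ∈ S, i ∈ T' ∧ e ∈ i.P ∧ δ * (SAPTask.b u i : ℝ) < (i.d : ℝ) := by
    intro i hi
    exact Finset.mem_filter.mp hi
  have key := aux_growth δ h n S (u e) hn
    (by
      intro i hi
      obtain ⟨a, b, _⟩ := hmem i hi
      exact_mod_cast hcap i a e b)
    (by
      intro i hi
      obtain ⟨a, b, c⟩ := hmem i hi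
      have h1 : h i + i.d ≤ SAPTask.b u i := by
        unfold SAPTask.b
        exact Finset.le_inf' _ _ (fun f hf => hcap i a f hf)
      have h2 : (h i : ℝ) + i.d ≤ SAPTask.b u i := by exact_mod_cast h1
      have := mul_le_mul_of_nonneg_left h2 hδ0.le
      linarith)
    (by
      intro i hi j hj hne
      obtain ⟨a, b, _⟩ := hmem i hi
      obtain ⟨a', b', _⟩ := hmem j hj
      exact hdis i a j a' hne ⟨e, Finset.mem_inter.mpr ⟨b, b'⟩⟩)
  have hlog : δ * n ≤ Real.log (u e) := by
    rw [Real.le_log_iff_exp_le (by linarith)]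
    exact key
  have hn2 : (n : ℝ) ≤ (1 / δ) * Real.log (u e) := by
    rw [one_div, ← div_eq_inv_mul, le_div_iff₀ hδ0]
    linarith
  have h6 : Real.log (u e) ≤ (1 / δ) * (Real.log (u e) / Real.log (1 / δ)) := by
    rw [← mul_div_assoc, le_div_iff₀ hlogd, mul_comm (1 / δ)]
    exact mul_le_mul_of_nonneg_left hlogd2 hlogu
  have h7 := mul_le_mul_of_nonneg_left h6 (by linarith : (0 : ℝ) ≤ 1 / δ)
  have h8 : 1 ≤ (1 / δ) * (1 / δ) := by nlinarith
  rw [hn, hsq]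
  push_cast
  rw [mul_add, mul_one, mul_assoc]
  linarith
end

section
/- Let δ > 0 and k ∈ ℕ. Let I be a finite family of pairwise disjoint half-open intervals [h_i, h_i + d_i) with h_i ≥ 0 and d_i > δ·(h_i + d_i) for every i. Then at most two members of I have nonempty intersection with the corridor [(1+δ)^k, (1+δ)^{k+1}). -/
open Classical in
/-- At most two members of a finite family of pairwise disjoint half-open intervals
`[h_i, h_i + d_i)` with `h_i ≥ 0` and `d_i > δ·(h_i + d_i)` intersect the corridor
`[(1+δ)^k, (1+δ)^{k+1})`. -/
theorem at_most_two_large_tasks_per_corridor {ι : Type*} (δ : ℝ) (hδ : 0 < δ) (k : ℕ)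
    (I : Finset ι) (h d : ι → ℝ)
    (hh : ∀ i ∈ I, 0 ≤ h i)
    (hd : ∀ i ∈ I, d i > δ * (h i + d i))
    (hdisj : ∀ i ∈ I, ∀ j ∈ I, i ≠ j →
      Disjoint (Set.Ico (h i) (h i + d i)) (Set.Ico (h j) (h j + d j))) :
    (I.filter (fun i =>
      (Set.Ico (h i) (h i + d i) ∩
        Set.Ico ((1 + δ) ^ k) ((1 + δ) ^ (k + 1))).Nonempty)).card ≤ 2 := by
  by_contra hcon
  rw [not_le, Finset.two_lt_card] at hcon
  obtain ⟨a, ha, b, hb, c, hc, hab, hac, hbc⟩ := hcon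
  rw [Finset.mem_filter] at ha hb hc
  obtain ⟨ha, x, ⟨hx1, hx2⟩, hx3, hx4⟩ := ha
  obtain ⟨hb, y, ⟨hy1, hy2⟩, hy3, hy4⟩ := hb
  obtain ⟨hc, z, ⟨hz1, hz2⟩, hz3, hz4⟩ := hc
  rw [pow_succ] at hx4 hy4 hz4
  generalize (1 + δ) ^ k = A at *
  have sep : ∀ i ∈ I, ∀ j ∈ I, i ≠ j → 0 < d i → 0 < d j →
      h i + d i ≤ h j ∨ h j + d j ≤ h i := by
    intro i hi j hj hij hdi hdj
    by_contra hne
    rw [not_or, not_le, not_le] at hne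
    refine (Set.disjoint_left.mp (hdisj i hi j hj hij) : _) (show max (h i) (h j) ∈ _ from ?_) ?_
    · exact ⟨le_max_left _ _, max_lt (by linarith) hne.1⟩
    · exact ⟨le_max_right _ _, max_lt hne.2 (by linarith)⟩
  have mid : ∀ j ∈ I, A < h j → h j + d j < A * (1 + δ) → 0 < d j → False := by
    intro j hj h1 h2 h3
    have h4 := hd j hj
    have h5 : δ * A < δ * (h j + d j) := mul_lt_mul_of_pos_left (by linarith) hδ
    nlinarith
  have da : 0 < d a := by linarith
  have db : 0 < d b := by linarith
  have dc : 0 < d c := by linarith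
  have ma := mid a ha
  have mb := mid b hb
  have mc := mid c hc
  rcases sep a ha b hb hab da db with h1 | h1 <;>
  rcases sep a ha c hc hac da dc with h2 | h2 <;>
  rcases sep b hb c hc hbc db dc with h3 | h3 <;>
  first
  | linarith
  | exact ma (by linarith) (by linarith) da
  | exact mb (by linarith) (by linarith) db
  | exact mc (by linarith) (by linarith) dc
end

section
/- Let J be a finite set of tasks, each j ∈ J carrying a weight w_j ≥ 0 and a demand d_j > 0. Let Q be a finite set of pairs (j,t) with j ∈ J and t ∈ ℝ, t ≥ 0, and let x : Q → [0,1] satisfy: (a) for every j ∈ J, ∑_{t : (j,t) ∈ Q} x(j,t) ≤ 1; and (b) for every y ∈ ℝ, ∑_{(j,t) ∈ Q : t ≤ y < t + d_j} x(j,t) ≤ 1. Then there exists a subset S ⊆ Q such that: S contains at most one pair with first coordinate j for each j ∈ J; for any two distinct pairs (j,t), (j',t') ∈ S the intervals [t, t+d_j) and [t', t'+d_{j'}) are disjoint; and ∑_{(j,t) ∈ S} w_j ≥ (1/4)·∑_{(j,t) ∈ Q} x(j,t)·w_j. -/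
open Classical in
/-- Local-ratio lemma: conflict relation `N`, elements processed by decreasing `t`. -/
theorem local_ratio_aux {α : Type*} (N : α → α → Prop) (hrefl : ∀ a, N a a)
    (hsymm : ∀ a b, N a b → N b a) (t : α → ℝ) (x : α → ℝ) :
    ∀ (n : ℕ) (Q : Finset α), Q.card = n → (∀ q ∈ Q, 0 ≤ x q) →
    (∀ q ∈ Q, ∑ p ∈ Q.filter (fun p => t p ≤ t q ∧ N q p), x p ≤ 2) →
    ∀ w : α → ℝ, ∃ S ⊆ Q, (∀ p ∈ S, ∀ p' ∈ S, p ≠ p' → ¬ N p p') ∧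
      (1 / 2) * ∑ q ∈ Q, x q * w q ≤ ∑ p ∈ S, w p := by
  intro n
  induction n with
  | zero =>
    intro Q hc _ _ w
    have hQ : Q = ∅ := Finset.card_eq_zero.mp hc
    subst hQ
    exact ⟨∅, by simp, by simp, by simp⟩
  | succ n ih =>
    intro Q hc hx hN w
    have hne : Q.Nonempty := Finset.card_pos.mp (by omega)
    obtain ⟨q, hq, hmax⟩ := Finset.exists_max_image Q t hne
    have hc' : (Q.erase q).card = n := by rw [Finset.card_erase_of_mem hq]; omega
    have hsub : Q.erase q ⊆ Q := Finset.erase_subset _ _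
    have hx' : ∀ p ∈ Q.erase q, 0 ≤ x p := fun p hp => hx p (hsub hp)
    have hN' : ∀ r ∈ Q.erase q,
        ∑ p ∈ (Q.erase q).filter (fun p => t p ≤ t r ∧ N r p), x p ≤ 2 := by
      intro r hr
      refine le_trans ?_ (hN r (hsub hr))
      apply Finset.sum_le_sum_of_subset_of_nonneg
      · exact Finset.filter_subset_filter _ hsub
      · intro i hi _
        exact hx i (Finset.mem_filter.mp hi).1
    by_cases hwq : w q ≤ 0
    · obtain ⟨S, hS, hI, hw⟩ := ih (Q.erase q) hc' hx' hN' w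
      refine ⟨S, hS.trans hsub, hI, le_trans ?_ hw⟩
      have h1 := Finset.add_sum_erase Q (fun p => x p * w p) hq
      have h2 : x q * w q ≤ 0 := mul_nonpos_of_nonneg_of_nonpos (hx q hq) hwq
      linarith
    · push Not at hwq
      obtain ⟨S, hS, hI, hw⟩ := ih (Q.erase q) hc' hx' hN'
        (fun p => w p - if N q p then w q else 0)
      have hqS : q ∉ S := fun h => by simpa using hS h
      have hsum : ∑ p ∈ Q, x p * w p ≤
          ∑ p ∈ Q.erase q, x p * (w p - if N q p then w q else 0) + 2 * w q := by
        have h1 := Finset.add_sum_erase Q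
          (fun p => x p * (w p - if N q p then w q else 0)) hq
        simp only [hrefl q, if_true, sub_self, mul_zero, zero_add] at h1
        rw [h1]
        have h2 : ∑ p ∈ Q, x p * (w p - if N q p then w q else 0)
            = ∑ p ∈ Q, x p * w p - (∑ p ∈ Q.filter (fun p => t p ≤ t q ∧ N q p), x p) * w q := by
          rw [Finset.sum_filter, Finset.sum_mul, ← Finset.sum_sub_distrib]
          apply Finset.sum_congr rfl
          intro p hp
          have := hmax p hp
          by_cases h : N q p <;> simp [h, this]
          ring
        rw [h2]
        have := mul_le_mul_of_nonneg_right (hN q hq) hwq.le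
        linarith
      by_cases hex : ∃ s ∈ S, N q s
      · obtain ⟨s, hs, hqs⟩ := hex
        refine ⟨S, hS.trans hsub, hI, ?_⟩
        rw [Finset.sum_sub_distrib] at hw
        have h3 : w q ≤ ∑ p ∈ S, if N q p then w q else 0 := by
          have := Finset.single_le_sum (f := fun p => if N q p then w q else 0) (s := S)
            (fun i _ => by split_ifs <;> linarith) hs
          simpa [hqs] using this
        linarith
      · push Not at hex
        refine ⟨insert q S, ?_, ?_, ?_⟩
        · exact Finset.insert_subset hq (hS.trans hsub)
        · intro p hp p' hp' hne
          rcases Finset.mem_insert.mp hp with rfl | hp1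
          · rcases Finset.mem_insert.mp hp' with rfl | hp'
            · exact absurd rfl hne
            · exact hex p' hp'
          · rcases Finset.mem_insert.mp hp' with rfl | hp'
            · exact fun h => hex p hp1 (hsymm _ _ h)
            · exact hI p hp1 p' hp' hne
        · rw [Finset.sum_insert hqS]
          have h4 : ∑ p ∈ S, (w p - if N q p then w q else 0) = ∑ p ∈ S, w p := by
            apply Finset.sum_congr rfl
            intro p hp
            simp [hex p hp]
          rw [h4] at hw
          linarith

open Classical in
/-- Randomized rounding with alteration for the stair-block LP: from a fractional solution
`x` over (task, height) pairs whose intervals fractionally pack every point of the vertical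
line, one can extract an integral conflict-free set of pairs (at most one height per task,
pairwise disjoint height intervals) of weight at least one quarter of the fractional
weight. -/
theorem rounding_with_alteration {ι : Type*} (J : Finset ι) (w d : ι → ℝ)
    (hw : ∀ j ∈ J, 0 ≤ w j) (hd : ∀ j ∈ J, 0 < d j)
    (Q : Finset (ι × ℝ)) (hQ : ∀ q ∈ Q, q.1 ∈ J ∧ 0 ≤ q.2)
    (x : ι × ℝ → ℝ) (hx : ∀ q ∈ Q, 0 ≤ x q ∧ x q ≤ 1)
    (ha : ∀ j ∈ J, ∑ q ∈ Q.filter (fun q => q.1 = j), x q ≤ 1)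
    (hb : ∀ y : ℝ, ∑ q ∈ Q.filter (fun q => q.2 ≤ y ∧ y < q.2 + d q.1), x q ≤ 1) :
    ∃ S ⊆ Q,
      (∀ p ∈ S, ∀ p' ∈ S, p ≠ p' →
        p.1 ≠ p'.1 ∧
        Disjoint (Set.Ico p.2 (p.2 + d p.1)) (Set.Ico p'.2 (p'.2 + d p'.1))) ∧
      (1 / 4) * ∑ q ∈ Q, x q * w q.1 ≤ ∑ p ∈ S, w p.1 := by
  obtain ⟨S, hS, hI, hwS⟩ := local_ratio_aux
    (fun p p' : ι × ℝ => p.1 = p'.1 ∨ p = p' ∨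
      ¬ Disjoint (Set.Ico p.2 (p.2 + d p.1)) (Set.Ico p'.2 (p'.2 + d p'.1)))
    (fun a => Or.inl rfl)
    (fun a b h => by
      rcases h with h | h | h
      · exact Or.inl h.symm
      · exact Or.inr (Or.inl h.symm)
      · exact Or.inr (Or.inr fun h' => h h'.symm))
    (fun p => p.2) x Q.card Q rfl (fun q hq => (hx q hq).1)
    (by
      intro q hq
      have h1 := ha q.1 (hQ q hq).1
      have h2 := hb q.2
      rw [Finset.sum_filter] at h1 h2 ⊢
      have h3 : ∀ p ∈ Q, (if p.2 ≤ q.2 ∧ (q.1 = p.1 ∨ q = p ∨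
          ¬ Disjoint (Set.Ico q.2 (q.2 + d q.1)) (Set.Ico p.2 (p.2 + d p.1))) then x p else 0)
          ≤ (if p.1 = q.1 then x p else 0) +
            (if p.2 ≤ q.2 ∧ q.2 < p.2 + d p.1 then x p else 0) := by
        intro p hp
        have hp0 := (hx p hp).1
        by_cases hA : p.1 = q.1
        · rw [if_pos hA]
          split_ifs <;> linarith
        · rw [if_neg hA]
          by_cases hB : p.2 ≤ q.2 ∧ q.2 < p.2 + d p.1
          · rw [if_pos hB]
            split_ifs <;> linarith
          · rw [if_neg hB, if_neg]
            · simp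
            · rintro ⟨hle, h | h | h⟩
              · exact hA h.symm
              · exact hA (by rw [h])
              · obtain ⟨y, hy1, hy2⟩ := Set.not_disjoint_iff.mp h
                exact hB ⟨hle, lt_of_le_of_lt hy1.1 hy2.2⟩
      have h4 := Finset.sum_le_sum h3
      rw [Finset.sum_add_distrib] at h4
      refine le_trans (le_of_eq (Finset.sum_congr rfl fun p _ => ?_))
        (h4.trans (by linarith))
      congr)
    (fun p => w p.1)
  refine ⟨S, hS, ?_, ?_⟩
  · intro p hp p' hp' hne
    have := hI p hp p' hp' hne
    push Not at this
    exact ⟨this.1, this.2.2⟩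
  · have h0 : 0 ≤ ∑ q ∈ Q, x q * w q.1 :=
      Finset.sum_nonneg fun q hq => mul_nonneg (hx q hq).1 (hw _ (hQ q hq).1)
    linarith
end

section
/- Let δ' ∈ (0,1). Let u* assign to each edge a capacity u*_e ∈ ℕ. Let S be a finite set of tasks, each i'' ∈ S with a path P(i'') (a nonempty finite interval of edges), a demand d_{i''} ≥ 1 and a height h(i'') ≥ 0, such that: (a) h(i'') + d_{i''} ≤ u*_e for every e ∈ P(i''); (b) for any two distinct tasks of S whose paths share an edge, the intervals [h(i''), h(i'')+d_{i''}) are disjoint; and (c) every i'' ∈ S is δ'-jammed, i.e. there exists an edge e ∈ P(i'') with d_{i''} > δ'·u*_e. Fix i ∈ S and let e(i) ∈ P(i) be an edge attaining min_{e ∈ P(i)} u*_e. Then the number of tasks i' ∈ S with e(i) ∈ P(i') and h(i') > h(i) is strictly less than 1/(δ')². -/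
open Classical in
/-- At most `1/δ'² - 1` jammed tasks are stacked above a given jammed task `i` over the
bottleneck edge `e(i)` of `i` (with respect to the pseudo-capacities `u*`). -/
theorem few_jammed_tasks_above (δ' : ℝ) (hδ'0 : 0 < δ') (hδ'1 : δ' < 1)
    (ustar : ℕ → ℕ) (S : Finset SAPTask) (h : SAPTask → ℕ)
    (hcap : ∀ i ∈ S, ∀ e ∈ i.P, h i + i.d ≤ ustar e)
    (hdisj : ∀ i ∈ S, ∀ i' ∈ S, i ≠ i' → (i.P ∩ i'.P).Nonempty →
      (h i + i.d ≤ h i' ∨ h i' + i'.d ≤ h i))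
    (hjam : ∀ i ∈ S, ∃ e ∈ i.P, δ' * (ustar e : ℝ) < (i.d : ℝ))
    (i : SAPTask) (hi : i ∈ S) (e : ℕ) (he : e ∈ i.P)
    (hmin : ∀ e' ∈ i.P, ustar e ≤ ustar e') :
    ((S.filter (fun i' => e ∈ i'.P ∧ h i < h i')).card : ℝ) < 1 / δ' ^ 2 := by
  set F := S.filter (fun i' => e ∈ i'.P ∧ h i < h i') with hF
  have hab : ∀ j ∈ F, j ∈ S ∧ e ∈ j.P ∧ h i + i.d ≤ h j := by
    intro j hj
    obtain ⟨hjS, hje, hlt⟩ := Finset.mem_filter.mp hj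
    refine ⟨hjS, hje, ?_⟩
    have hne : i ≠ j := by rintro rfl; exact lt_irrefl _ hlt
    rcases hdisj i hi j hjS hne ⟨e, Finset.mem_inter.mpr ⟨he, hje⟩⟩ with h1 | h1
    · exact h1
    · omega
  have hsum : ∑ j ∈ F, j.d ≤ ustar e - (h i + i.d) := by
    have hd : (F : Set SAPTask).PairwiseDisjoint (fun j => Finset.Ico (h j) (h j + j.d)) := by
      intro a ha b hb hne
      obtain ⟨haS, hae, -⟩ := hab a ha
      obtain ⟨hbS, hbe, -⟩ := hab b hb
      have := hdisj a haS b hbS hne ⟨e, Finset.mem_inter.mpr ⟨hae, hbe⟩⟩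
      refine Finset.disjoint_left.mpr fun x hx hy => ?_
      simp only [Finset.mem_Ico] at hx hy
      omega
    have hc := Finset.card_biUnion hd
    simp only [Nat.card_Ico, Nat.add_sub_cancel_left] at hc
    rw [← hc, ← Nat.card_Ico]
    apply Finset.card_le_card
    intro x hx
    obtain ⟨j, hj, hxj⟩ := Finset.mem_biUnion.mp hx
    obtain ⟨hjS, hje, hle⟩ := hab j hj
    have := hcap j hjS e hje
    simp only [Finset.mem_Ico] at hxj ⊢
    omega
  have hdi := i.hd
  have hci := hcap i hi e he
  have hlt : ∑ j ∈ F, j.d < ustar e := by omega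
  have hltR : ((∑ j ∈ F, j.d : ℕ) : ℝ) < (ustar e : ℝ) := by exact_mod_cast hlt
  have hU : (0 : ℝ) < (ustar e : ℝ) := by
    have : 0 < ustar e := by omega
    exact_mod_cast this
  have hbig : δ' * (ustar e : ℝ) < (i.d : ℝ) := by
    obtain ⟨e', he', hj⟩ := hjam i hi
    have h1 : (ustar e : ℝ) ≤ (ustar e' : ℝ) := by exact_mod_cast hmin e' he'
    exact lt_of_le_of_lt (mul_le_mul_of_nonneg_left h1 hδ'0.le) hj
  have heach : ∀ j ∈ F, δ' ^ 2 * (ustar e : ℝ) ≤ (j.d : ℝ) := by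
    intro j hj
    obtain ⟨hjS, hje, hle⟩ := hab j hj
    obtain ⟨e', he', hjm⟩ := hjam j hjS
    have h0 := hcap j hjS e' he'
    have h1 : (i.d : ℝ) ≤ (ustar e' : ℝ) := by
      have : i.d ≤ ustar e' := by omega
      exact_mod_cast this
    have h2 := mul_le_mul_of_nonneg_left (hbig.le.trans h1) hδ'0.le
    nlinarith
  have hk := Finset.card_nsmul_le_sum F (fun j => (j.d : ℝ)) _ heach
  rw [nsmul_eq_mul] at hk
  push_cast at hltR
  rw [lt_div_iff₀ (by positivity)]
  have h3 : (F.card : ℝ) * δ' ^ 2 * (ustar e : ℝ) < 1 * (ustar e : ℝ) := by linarith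
  exact lt_of_mul_lt_mul_right h3 hU.le
end
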